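/- Disagreement bound for the descent-direction iterate (Lemma 2, inequality for z̃): under the DQN recurrence, for every k ≥ 0, ‖z̃^{(k+1)}‖₂ ≤ λ q (‖ṽ^{(k+1)}‖₂ + ‖ḡ^{(k+1)}‖₂), where ḡ^{(k+1)} is the row-wise mean of g(x^{(k+1)}). -/

import Mathlib

open Matrix Filter Topology

/-- Spectral norm (largest singular value) of a real matrix. -/
noncomputable def specNorm {m n : ℕ} (A : Matrix (Fin m) (Fin n) ℝ) : ℝ :=
  ‖LinearMap.toContinuousLinearMap (Matrix.toEuclideanLin A)‖

/-- Row-wise mean `(1/N) 11ᵀ A` of a matrix. -/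
noncomputable def rowMean {N n : ℕ} (A : Matrix (Fin N) (Fin n) ℝ) : Matrix (Fin N) (Fin n) ℝ :=
  ((1 : ℝ) / N) • (Matrix.of (fun _ _ => (1 : ℝ)) * A)

/-- The stacked-gradient matrix `g(x)` whose `i`-th row is `∇f_i(x_i)ᵀ`. -/
noncomputable def gradMat {N n : ℕ} (f : Fin N → EuclideanSpace ℝ (Fin n) → ℝ)
    (x : Matrix (Fin N) (Fin n) ℝ) : Matrix (Fin N) (Fin n) ℝ :=
  Matrix.of fun i j =>
    WithLp.equiv 2 (Fin n → ℝ) (gradient (f i) ((WithLp.equiv 2 (Fin n → ℝ)).symm (x i))) j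

section SpectralNorm

open scoped Matrix.Norms.L2Operator

variable {l m n : ℕ}

theorem specNorm_eq_l2_opNorm (A : Matrix (Fin m) (Fin n) ℝ) : specNorm A = ‖A‖ :=
  (Matrix.l2_opNorm_def A).symm

theorem specNorm_nonneg (A : Matrix (Fin m) (Fin n) ℝ) : 0 ≤ specNorm A :=
  norm_nonneg _

theorem specNorm_add_le (A B : Matrix (Fin m) (Fin n) ℝ) :
    specNorm (A + B) ≤ specNorm A + specNorm B := by
  simpa only [specNorm_eq_l2_opNorm] using norm_add_le A B

theorem specNorm_mul_le (A : Matrix (Fin l) (Fin m) ℝ) (B : Matrix (Fin m) (Fin n) ℝ) :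
    specNorm (A * B) ≤ specNorm A * specNorm B := by
  simpa only [specNorm_eq_l2_opNorm] using Matrix.l2_opNorm_mul A B

theorem specNorm_transpose (A : Matrix (Fin m) (Fin n) ℝ) : specNorm Aᵀ = specNorm A := by
  simpa only [specNorm_eq_l2_opNorm, Matrix.conjTranspose_eq_transpose_of_trivial]
    using Matrix.l2_opNorm_conjTranspose A

theorem sum_sq_mulVec_le (A : Matrix (Fin m) (Fin n) ℝ) (x : Fin n → ℝ) :
    ∑ i, (A *ᵥ x) i ^ 2 ≤ specNorm A ^ 2 * ∑ j, x j ^ 2 := by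
  have h := Matrix.l2_opNorm_mulVec A (WithLp.toLp 2 x)
  rw [← specNorm_eq_l2_opNorm] at h
  have h2 := pow_le_pow_left₀ (norm_nonneg _) h 2
  rw [mul_pow, EuclideanSpace.real_norm_sq_eq, EuclideanSpace.real_norm_sq_eq] at h2
  exact h2

/-- The spectral norm is at most the Frobenius norm. -/
theorem specNorm_sq_le_sum_sq (A : Matrix (Fin m) (Fin n) ℝ) :
    specNorm A ^ 2 ≤ ∑ i, ∑ j, A i j ^ 2 := by
  have hF : 0 ≤ ∑ i, ∑ j, A i j ^ 2 := by positivity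
  have h : specNorm A ≤ √(∑ i, ∑ j, A i j ^ 2) := by
    refine ContinuousLinearMap.opNorm_le_bound _ (Real.sqrt_nonneg _) fun x => ?_
    refine le_of_abs_le <| abs_le_of_sq_le_sq ?_ (by positivity)
    rw [mul_pow, Real.sq_sqrt hF, EuclideanSpace.real_norm_sq_eq, EuclideanSpace.real_norm_sq_eq,
      Finset.sum_mul]
    refine Finset.sum_le_sum fun i _ => ?_
    change (∑ j, A i j * x j) ^ 2 ≤ _
    exact Finset.sum_mul_sq_le_sq_mul_sq _ (A i) x
  calc specNorm A ^ 2 ≤ √(∑ i, ∑ j, A i j ^ 2) ^ 2 := pow_le_pow_left₀ (specNorm_nonneg A) h 2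
    _ = _ := Real.sq_sqrt hF

theorem sum_sq_le_card_cols_mul_specNorm_sq (A : Matrix (Fin m) (Fin n) ℝ) :
    ∑ i, ∑ j, A i j ^ 2 ≤ n * specNorm A ^ 2 := by
  rw [Finset.sum_comm]
  have h : ∀ j, ∑ i, A i j ^ 2 ≤ specNorm A ^ 2 := fun j => by
    simpa [Pi.single_apply, ite_pow] using sum_sq_mulVec_le A (Pi.single j 1)
  simpa using Finset.sum_le_sum fun j (_ : j ∈ Finset.univ) => h j

/-- The Frobenius norm is at most `√(min n m)` times the spectral norm. -/
theorem sum_sq_le_min_mul_specNorm_sq (A : Matrix (Fin m) (Fin n) ℝ) :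
    ∑ i, ∑ j, A i j ^ 2 ≤ min (n : ℝ) m * specNorm A ^ 2 := by
  rw [min_mul_of_nonneg _ _ (sq_nonneg _)]
  refine le_min (sum_sq_le_card_cols_mul_specNorm_sq A) ?_
  have h := sum_sq_le_card_cols_mul_specNorm_sq Aᵀ
  rwa [specNorm_transpose, Finset.sum_comm] at h

/-- Applying to each row of `V` a matrix of spectral norm at most `γ` inflates the spectral norm
by a factor at most `γ √(min n m)`. -/
theorem specNorm_rowwise_mulVec_le {γ : ℝ} (hγ : 0 ≤ γ) (C : Fin m → Matrix (Fin n) (Fin n) ℝ)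
    (hC : ∀ i, specNorm (C i) ≤ γ) (V D : Matrix (Fin m) (Fin n) ℝ)
    (hD : ∀ i, D i = -(C i *ᵥ V i)) :
    specNorm D ≤ γ * √(min (n : ℝ) m) * specNorm V := by
  refine le_of_abs_le <| abs_le_of_sq_le_sq ?_ (mul_nonneg (by positivity) (specNorm_nonneg V))
  calc specNorm D ^ 2 ≤ ∑ i, ∑ j, D i j ^ 2 := specNorm_sq_le_sum_sq D
    _ ≤ ∑ i, γ ^ 2 * ∑ j, V i j ^ 2 := by
        refine Finset.sum_le_sum fun i _ => ?_
        simp only [hD i, Pi.neg_apply, neg_sq]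
        refine (sum_sq_mulVec_le (C i) (V i)).trans ?_
        gcongr
        · exact specNorm_nonneg _
        · exact hC i
    _ ≤ γ ^ 2 * (min (n : ℝ) m * specNorm V ^ 2) := by
        rw [← Finset.mul_sum]
        gcongr
        exact sum_sq_le_min_mul_specNorm_sq V
    _ = (γ * √(min (n : ℝ) m) * specNorm V) ^ 2 := by
        rw [mul_pow, mul_pow, Real.sq_sqrt (by positivity)]
        ring

end SpectralNorm

section RowMean

variable {N n : ℕ}

theorem rowMean_eq (A : Matrix (Fin N) (Fin n) ℝ) :
    rowMean A =
      ((1 : ℝ) / N) • ((Matrix.of fun _ _ => 1 : Matrix (Fin N) (Fin N) ℝ) * A) :=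
  rfl

theorem rowMean_add (A B : Matrix (Fin N) (Fin n) ℝ) :
    rowMean (A + B) = rowMean A + rowMean B := by
  simp only [rowMean_eq, Matrix.mul_add, smul_add]

theorem rowMean_sub (A B : Matrix (Fin N) (Fin n) ℝ) :
    rowMean (A - B) = rowMean A - rowMean B := by
  simp only [rowMean_eq, Matrix.mul_sub, smul_sub]

/-- A matrix with unit column sums preserves row-wise means. -/
theorem rowMean_mul {W : Matrix (Fin N) (Fin N) ℝ}
    (h1W : (fun _ => (1 : ℝ)) ᵥ* W = fun _ => 1) (A : Matrix (Fin N) (Fin n) ℝ) :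
    rowMean (W * A) = rowMean A := by
  have h : Matrix.of (fun _ _ : Fin N => (1 : ℝ)) * W = Matrix.of (fun _ _ => (1 : ℝ)) := by
    ext i j
    exact congrFun h1W j
  rw [rowMean_eq, rowMean_eq, ← Matrix.mul_assoc, h]

/-- The gradient-tracking invariant: the tracker and the tracked sequence have the same row-wise
mean. -/
theorem rowMean_tracking {W : Matrix (Fin N) (Fin N) ℝ}
    (h1W : (fun _ => (1 : ℝ)) ᵥ* W = fun _ => 1) {v g : ℕ → Matrix (Fin N) (Fin n) ℝ}
    (h0 : v 0 = g 0) (hv : ∀ k, v (k + 1) = W * (v k + g (k + 1) - g k)) (k : ℕ) :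
    rowMean (v k) = rowMean (g k) := by
  induction k with
  | zero => rw [h0]
  | succ k ih => rw [hv, rowMean_mul h1W, rowMean_sub, rowMean_add, ih, add_sub_cancel_left]

end RowMean

theorem dqn_descent_direction_disagreement_bound
    {N n : ℕ} (hN : 0 < N) (hn : 0 < n)
    (f : Fin N → EuclideanSpace ℝ (Fin n) → ℝ)
    (hdiff : ∀ i, Differentiable ℝ (f i))
    (W : Matrix (Fin N) (Fin N) ℝ)
    (hW1 : W *ᵥ (fun _ => (1 : ℝ)) = fun _ => 1)
    (h1W : (fun _ => (1 : ℝ)) ᵥ* W = fun _ => 1)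
    (lam : ℝ)
    (hlam : lam = specNorm (W - ((1 : ℝ) / N) • Matrix.of (fun _ _ => (1 : ℝ))))
    (γ : ℝ) (hγ : 0 < γ)
    (C : ℕ → Fin N → Matrix (Fin n) (Fin n) ℝ)
    (hCsymm : ∀ k i, (C k i).IsSymm)
    (hCpos : ∀ k i, (C k i).PosDef)
    (hCnorm : ∀ k i, specNorm (C k i) ≤ γ)
    (α : ℕ → Fin N → ℝ) (hα : ∀ k i, 0 < α k i)
    (x v z d : ℕ → Matrix (Fin N) (Fin n) ℝ)
    (hx : ∀ k, x (k + 1) = W * (x k + Matrix.diagonal (α k) * z k))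
    (hv0 : v 0 = gradMat f (x 0))
    (hv : ∀ k, v (k + 1) = W * (v k + gradMat f (x (k + 1)) - gradMat f (x k)))
    (hd : ∀ k i, d k i = -(C k i *ᵥ v k i))
    (hz0 : z 0 = W * d 0)
    (hz : ∀ k, z (k + 1) = W * d (k + 1))
    (q : ℝ) (hq : q = γ * Real.sqrt (min (n : ℝ) (N : ℝ)))
    :
    ∀ k, specNorm (z (k + 1) - rowMean (z (k + 1))) ≤
      lam * q * (specNorm (v (k + 1) - rowMean (v (k + 1))) +
        specNorm (rowMean (gradMat f (x (k + 1))))) := by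
  intro k
  have hmean : rowMean (v (k + 1)) = rowMean (gradMat f (x (k + 1))) :=
    rowMean_tracking (g := fun k => gradMat f (x k)) h1W hv0 hv (k + 1)
  have hM : z (k + 1) - rowMean (z (k + 1)) =
      (W - ((1 : ℝ) / N) • Matrix.of (fun _ _ => (1 : ℝ))) * d (k + 1) := by
    rw [hz, rowMean_mul h1W, rowMean_eq, Matrix.sub_mul, Matrix.smul_mul]
  have hlam0 : 0 ≤ lam := hlam ▸ specNorm_nonneg _
  have hq0 : 0 ≤ q := hq ▸ by positivity
  have hD : specNorm (d (k + 1)) ≤ q * specNorm (v (k + 1)) :=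
    hq ▸ specNorm_rowwise_mulVec_le hγ.le _ (hCnorm (k + 1)) _ _ (hd (k + 1))
  have hV : specNorm (v (k + 1)) ≤ specNorm (v (k + 1) - rowMean (v (k + 1))) +
      specNorm (rowMean (gradMat f (x (k + 1)))) := by
    rw [← hmean]
    simpa using specNorm_add_le (v (k + 1) - rowMean (v (k + 1))) (rowMean (v (k + 1)))
  rw [hM, mul_assoc]
  refine (specNorm_mul_le _ _).trans ?_
  rw [← hlam]
  gcongr
  exact hD.trans (by gcongr)
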